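/- arXiv:1803.04233 — 2 statements merged into one kernel-verified Lean document; each statement's English description precedes it below -/
import Mathlib

section
/- (Half-space case of Theorem 2.1, Neumann condition.) Let d ≥ 2, V : ℝ^d → ℝ smooth, and f ∈ C_c^∞(ℝ^d) satisfying the Neumann condition ∂_d f(x̂, 0) = 0 for all x̂ ∈ ℝ^{d−1}. Then ∫_H { (Lf)² − ‖Hess_f‖²_HS + Hess_V(∇f, ∇f) } dμ = 0. -/
open MeasureTheory Real

/-- Partial derivative `∂ᵢ f` on `ℝ^n = Fin n → ℝ`. -/
noncomputable def pd {n : ℕ} (i : Fin n) (f : (Fin n → ℝ) → ℝ) (x : Fin n → ℝ) : ℝ :=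
  fderiv ℝ f x (Pi.single i 1)

/-- Hessian entry `∂ᵢ∂ⱼ f`. -/
noncomputable def hess {n : ℕ} (i j : Fin n) (f : (Fin n → ℝ) → ℝ) (x : Fin n → ℝ) : ℝ :=
  pd i (pd j f) x

/-- Euclidean Laplacian `Δf`. -/
noncomputable def lap {n : ℕ} (f : (Fin n → ℝ) → ℝ) (x : Fin n → ℝ) : ℝ :=
  ∑ i, hess i i f x

/-- Weighted Laplacian `L f = Δ f + ⟨∇V, ∇f⟩`. -/
noncomputable def Lop {n : ℕ} (V f : (Fin n → ℝ) → ℝ) (x : Fin n → ℝ) : ℝ :=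
  lap f x + ∑ i, pd i V x * pd i f x

/-- Squared Hilbert-Schmidt norm of the Hessian of `f`. -/
noncomputable def hessHS2 {n : ℕ} (f : (Fin n → ℝ) → ℝ) (x : Fin n → ℝ) : ℝ :=
  ∑ i, ∑ j, (hess i j f x) ^ 2

/-- The Hessian of `V` as a bilinear form evaluated at vectors `u, v`. -/
noncomputable def hessBil {n : ℕ} (V : (Fin n → ℝ) → ℝ) (x : Fin n → ℝ)
    (u v : Fin n → ℝ) : ℝ :=
  ∑ i, ∑ j, hess i j V x * u i * v j

/-- The gradient `∇f`. -/
noncomputable def grad {n : ℕ} (f : (Fin n → ℝ) → ℝ) (x : Fin n → ℝ) : Fin n → ℝ :=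
  fun i => pd i f x

/-- The closed upper half-space `H = {x ∈ ℝ^{d+1} : x_{d+1} ≥ 0}`. -/
def upperHalf (d : ℕ) : Set (Fin (d + 1) → ℝ) := {x | 0 ≤ x (Fin.last d)}

section

variable {n : ℕ}

theorem ContDiff.pd {f : (Fin n → ℝ) → ℝ} (hf : ContDiff ℝ (⊤ : ℕ∞) f) (i : Fin n) :
    ContDiff ℝ (⊤ : ℕ∞) (pd i f) :=
  (hf.fderiv_right (m := (⊤ : ℕ∞)) (by simp)).clm_apply contDiff_const

theorem ContDiff.differentiableAt_of_smooth {f : (Fin n → ℝ) → ℝ}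
    (hf : ContDiff ℝ (⊤ : ℕ∞) f) (x : Fin n → ℝ) : DifferentiableAt ℝ f x :=
  (hf.differentiable (by simp)) x

theorem pd_mul (i : Fin n) {f g : (Fin n → ℝ) → ℝ} {x : Fin n → ℝ}
    (hf : DifferentiableAt ℝ f x) (hg : DifferentiableAt ℝ g x) :
    pd i (fun y => f y * g y) x = f x * pd i g x + pd i f x * g x := by
  simp only [pd, fderiv_fun_mul hf hg]
  simp [mul_comm]

theorem pd_add (i : Fin n) {f g : (Fin n → ℝ) → ℝ} {x : Fin n → ℝ}
    (hf : DifferentiableAt ℝ f x) (hg : DifferentiableAt ℝ g x) :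
    pd i (fun y => f y + g y) x = pd i f x + pd i g x := by
  simp only [pd, fderiv_fun_add hf hg]
  simp

theorem pd_sub (i : Fin n) {f g : (Fin n → ℝ) → ℝ} {x : Fin n → ℝ}
    (hf : DifferentiableAt ℝ f x) (hg : DifferentiableAt ℝ g x) :
    pd i (fun y => f y - g y) x = pd i f x - pd i g x := by
  simp only [pd, fderiv_fun_sub hf hg]
  simp

theorem pd_sum {ι : Type*} (s : Finset ι) (i : Fin n) {f : ι → (Fin n → ℝ) → ℝ} {x : Fin n → ℝ}
    (hf : ∀ j ∈ s, DifferentiableAt ℝ (f j) x) :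
    pd i (fun y => ∑ j ∈ s, f j y) x = ∑ j ∈ s, pd i (f j) x := by
  simp only [pd, fderiv_fun_sum hf]
  simp

theorem pd_exp (i : Fin n) {f : (Fin n → ℝ) → ℝ} {x : Fin n → ℝ} (hf : DifferentiableAt ℝ f x) :
    pd i (fun y => exp (f y)) x = exp (f x) * pd i f x := by
  simp only [pd, fderiv_exp hf]
  simp

theorem hess_comm {f : (Fin n → ℝ) → ℝ} (hf : ContDiff ℝ (⊤ : ℕ∞) f) (i j : Fin n) :
    hess i j f = hess j i f := by
  have key (k l : Fin n) (x : Fin n → ℝ) :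
      hess k l f x = fderiv ℝ (fderiv ℝ f) x (Pi.single k 1) (Pi.single l 1) := by
    have h := ((hf.fderiv_right (m := (⊤ : ℕ∞)) (by simp)).differentiable (by simp)) x
    change fderiv ℝ (fun y => fderiv ℝ f y (Pi.single l 1)) x (Pi.single k 1) = _
    rw [fderiv_clm_apply h (differentiableAt_const _)]
    simp
  funext x
  rw [key, key]
  exact (hf.contDiffAt.isSymmSndFDerivAt
    (by simpa using WithTop.coe_le_coe.2 (le_top : (2 : ℕ∞) ≤ ⊤))) _ _

theorem support_pd_subset (i : Fin n) (f : (Fin n → ℝ) → ℝ) :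
    Function.support (pd i f) ⊆ tsupport f := by
  intro x hx
  apply support_fderiv_subset ℝ
  intro h
  exact hx (by simp [pd, h])

theorem pd_eq_zero_of_forall_line {g : (Fin n → ℝ) → ℝ} {x : Fin n → ℝ} {j : Fin n}
    (hg : DifferentiableAt ℝ g x) (h : ∀ t : ℝ, g (x + t • Pi.single j 1) = 0) :
    pd j g x = 0 := by
  rw [pd, ← hg.lineDeriv_eq_fderiv, lineDeriv]
  simp [h]

/-- The Bochner flux `e^V (Lf ∇f - ½ ∇|∇f|²)`, whose divergence is the Reilly integrand. -/
noncomputable def bochnerFlux (V f : (Fin n → ℝ) → ℝ) (i : Fin n) (x : Fin n → ℝ) : ℝ :=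
  exp (V x) * (Lop V f x * pd i f x - ∑ j, pd j f x * hess i j f x)

theorem ContDiff.Lop {V f : (Fin n → ℝ) → ℝ} (hV : ContDiff ℝ (⊤ : ℕ∞) V)
    (hf : ContDiff ℝ (⊤ : ℕ∞) f) : ContDiff ℝ (⊤ : ℕ∞) (Lop V f) :=
  (ContDiff.sum fun i _ => (hf.pd i).pd i).add (ContDiff.sum fun i _ => (hV.pd i).mul (hf.pd i))

theorem contDiff_bochnerFlux {V f : (Fin n → ℝ) → ℝ} (hV : ContDiff ℝ (⊤ : ℕ∞) V)
    (hf : ContDiff ℝ (⊤ : ℕ∞) f) (i : Fin n) : ContDiff ℝ (⊤ : ℕ∞) (bochnerFlux V f i) :=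
  hV.exp.mul (((hV.Lop hf).mul (hf.pd i)).sub
    (ContDiff.sum fun j _ => (hf.pd j).mul ((hf.pd j).pd i)))

theorem pd_Lop {V f : (Fin n → ℝ) → ℝ} (hV : ContDiff ℝ (⊤ : ℕ∞) V)
    (hf : ContDiff ℝ (⊤ : ℕ∞) f) (i : Fin n) (x : Fin n → ℝ) :
    pd i (Lop V f) x = ∑ j, pd i (hess j j f) x +
      ∑ j, (pd j V x * hess i j f x + hess i j V x * pd j f x) := by
  have h1 (j : Fin n) := ((hf.pd j).pd j).differentiableAt_of_smooth x
  have h2 (j : Fin n) := ((hV.pd j).mul (hf.pd j)).differentiableAt_of_smooth x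
  have h3 := pd_add i (DifferentiableAt.fun_sum (u := Finset.univ) fun j _ => h1 j)
    (DifferentiableAt.fun_sum (u := Finset.univ) fun j _ => h2 j)
  rw [pd_sum _ _ fun j _ => h1 j, pd_sum _ _ fun j _ => h2 j] at h3
  refine h3.trans ?_
  congr 1
  refine Finset.sum_congr rfl fun j _ => ?_
  exact pd_mul i ((hV.pd j).differentiableAt_of_smooth x) ((hf.pd j).differentiableAt_of_smooth x)

theorem pd_bochnerFlux {V f : (Fin n → ℝ) → ℝ} (hV : ContDiff ℝ (⊤ : ℕ∞) V)
    (hf : ContDiff ℝ (⊤ : ℕ∞) f) (i : Fin n) (x : Fin n → ℝ) :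
    pd i (bochnerFlux V f i) x = exp (V x) *
      (Lop V f x * hess i i f x + pd i (Lop V f) x * pd i f x
        - ∑ j, (pd j f x * pd i (hess i j f) x + hess i j f x * hess i j f x)
        + pd i V x * (Lop V f x * pd i f x - ∑ j, pd j f x * hess i j f x)) := by
  have hs (j : Fin n) := ((hf.pd j).mul ((hf.pd j).pd i))
  have hp := (hV.Lop hf).mul (hf.pd i)
  have hS := ContDiff.sum (s := Finset.univ) fun j _ => hs j
  have h1 := pd_mul i (hV.exp.differentiableAt_of_smooth x)
    ((hp.sub hS).differentiableAt_of_smooth x)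
  have h2 := pd_sub i (hp.differentiableAt_of_smooth x) (hS.differentiableAt_of_smooth x)
  have h3 := pd_mul i ((hV.Lop hf).differentiableAt_of_smooth x)
    ((hf.pd i).differentiableAt_of_smooth x)
  have h4 := pd_sum Finset.univ i fun j _ => (hs j).differentiableAt_of_smooth x
  have h5 (j : Fin n) := pd_mul i ((hf.pd j).differentiableAt_of_smooth x)
    (((hf.pd j).pd i).differentiableAt_of_smooth x)
  rw [pd_exp i (hV.differentiableAt_of_smooth x)] at h1
  rw [h3, h4, Finset.sum_congr rfl fun j _ => h5 j] at h2
  rw [h2] at h1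
  refine h1.trans ?_
  change _ = exp (V x) * (Lop V f x * pd i (pd i f) x + pd i (Lop V f) x * pd i f x
    - ∑ j, (pd j f x * pd i (pd i (pd j f)) x + pd i (pd j f) x * pd i (pd j f) x)
    + pd i V x * (Lop V f x * pd i f x - ∑ j, pd j f x * pd i (pd j f) x))
  ring

/-- The pointwise weighted Bochner identity in divergence form. -/
theorem sum_pd_bochnerFlux {V f : (Fin n → ℝ) → ℝ} (hV : ContDiff ℝ (⊤ : ℕ∞) V)
    (hf : ContDiff ℝ (⊤ : ℕ∞) f) (x : Fin n → ℝ) :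
    ∑ i, pd i (bochnerFlux V f i) x =
      ((Lop V f x) ^ 2 - hessHS2 f x + hessBil V x (grad f x) (grad f x)) * exp (V x) := by
  have third (i j : Fin n) : pd i (hess i j f) x = pd j (hess i i f) x := by
    rw [hess_comm hf i j]
    exact congrFun (hess_comm (hf.pd i) i j) x
  have swap : ∑ i, ∑ j, pd j f x * pd i (hess i j f) x =
      ∑ i, ∑ j, pd i (hess j j f) x * pd i f x := by
    rw [Finset.sum_comm]
    refine Finset.sum_congr rfl fun i _ => Finset.sum_congr rfl fun j _ => ?_
    rw [third, mul_comm]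
  have swapV : ∑ i, ∑ j, pd i V x * (pd j f x * hess i j f x) =
      ∑ i, ∑ j, pd j V x * hess i j f x * pd i f x := by
    rw [Finset.sum_comm]
    refine Finset.sum_congr rfl fun i _ => Finset.sum_congr rfl fun j _ => ?_
    rw [hess_comm hf j i]
    ring
  have hsq : (Lop V f x) ^ 2 =
      ∑ i, Lop V f x * hess i i f x + ∑ i, pd i V x * (Lop V f x * pd i f x) := by
    rw [sq]
    nth_rewrite 2 [Lop]
    rw [lap, mul_add, Finset.mul_sum, Finset.mul_sum]
    congr 1
    exact Finset.sum_congr rfl fun i _ => by ring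
  have hB : hessBil V x (grad f x) (grad f x) =
      ∑ i, ∑ j, hess i j V x * pd j f x * pd i f x :=
    Finset.sum_congr rfl fun i _ => Finset.sum_congr rfl fun j _ => by simp only [grad]; ring
  simp only [pd_bochnerFlux hV hf, pd_Lop hV hf]
  rw [← Finset.mul_sum, mul_comm, hsq, hB, hessHS2]
  congr 1
  simp only [mul_sub, add_mul, Finset.sum_add_distrib, Finset.sum_sub_distrib,
    Finset.mul_sum, Finset.sum_mul, sq]
  rw [swap, swapV]
  ring

theorem bochnerFlux_eq_zero_of_notMem_tsupport (V : (Fin n → ℝ) → ℝ) {f : (Fin n → ℝ) → ℝ}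
    (i : Fin n) {x : Fin n → ℝ} (hx : x ∉ tsupport f) : bochnerFlux V f i x = 0 := by
  have h (j : Fin n) : pd j f x = 0 :=
    Function.notMem_support.1 fun hj => hx (support_pd_subset j f hj)
  simp [bochnerFlux, h]

theorem pd_bochnerFlux_eq_zero_of_notMem_tsupport (V : (Fin n → ℝ) → ℝ) {f : (Fin n → ℝ) → ℝ}
    (i : Fin n) {x : Fin n → ℝ} (hx : x ∉ tsupport f) : pd i (bochnerFlux V f i) x = 0 := by
  refine Function.notMem_support.1 fun h => hx ?_
  refine closure_minimal (fun y hy => ?_) (isClosed_tsupport f) (support_pd_subset i _ h)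
  by_contra hy'
  exact hy (bochnerFlux_eq_zero_of_notMem_tsupport V i hy')

theorem bochnerFlux_last_eq_zero {d : ℕ} (V : (Fin (d + 1) → ℝ) → ℝ) {f : (Fin (d + 1) → ℝ) → ℝ}
    (hf : ContDiff ℝ (⊤ : ℕ∞) f)
    (hNeumann : ∀ xb : Fin d → ℝ, pd (Fin.last d) f (Fin.snoc xb 0) = 0)
    {x : Fin (d + 1) → ℝ} (hx : x (Fin.last d) = 0) :
    bochnerFlux V f (Fin.last d) x = 0 := by
  have h0 (y : Fin (d + 1) → ℝ) (hy : y (Fin.last d) = 0) : pd (Fin.last d) f y = 0 := by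
    have hsnoc : Fin.snoc (α := fun _ => ℝ) (Fin.init y) 0 = y := by
      conv_rhs => rw [← Fin.snoc_init_self y, hy]
    exact hsnoc ▸ hNeumann (Fin.init y)
  rw [bochnerFlux, h0 x hx, Finset.sum_eq_zero]
  · simp
  intro j _
  rcases eq_or_ne j (Fin.last d) with rfl | hj
  · simp [h0 x hx]
  · rw [hess_comm hf, hess, pd_eq_zero_of_forall_line ((hf.pd _).differentiableAt_of_smooth x),
      mul_zero]
    intro t
    apply h0
    simp [hx, hj.symm]

end

/-- half-space case of Theorem 2.1, Neumann condition: for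
`f ∈ C_c^∞` with `∂_d f(xb, 0) = 0` for all `xb`,
`∫_H { (Lf)² − ‖Hess_f‖²_HS + Hess_V(∇f, ∇f) } dμ = 0`, where `μ = e^V dx`.
(Ambient dimension is `d + 1` with `d ≥ 1`, i.e. dimension `≥ 2`.) -/
theorem half_space_neumann_identity
    (d : ℕ) (hd : 1 ≤ d) (V f : (Fin (d + 1) → ℝ) → ℝ)
    (hV : ContDiff ℝ (⊤ : ℕ∞) V) (hf : ContDiff ℝ (⊤ : ℕ∞) f) (hfc : HasCompactSupport f)
    (hNeumann : ∀ xb : Fin d → ℝ, pd (Fin.last d) f (Fin.snoc xb 0) = 0) :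
    ∫ x in upperHalf d,
        ((Lop V f x) ^ 2 - hessHS2 f x + hessBil V x (grad f x) (grad f x))
          * exp (V x) = 0 := by
  obtain ⟨R₀, hR₀⟩ := hfc.isCompact.isBounded.subset_closedBall 0
  obtain ⟨R, hR, hRpos⟩ : ∃ R : ℝ, R₀ < R ∧ 0 < R :=
    ⟨max R₀ 0 + 1, by linarith [le_max_left R₀ 0], by linarith [le_max_right R₀ 0]⟩
  have hsupp {x : Fin (d + 1) → ℝ} (hx : x ∈ tsupport f) (i : Fin (d + 1)) : |x i| < R :=
    ((norm_le_pi_norm x i).trans (mem_closedBall_zero_iff.1 (hR₀ hx))).trans_lt hR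
  set a : Fin (d + 1) → ℝ := fun i => if i = Fin.last d then 0 else -R with ha
  set b : Fin (d + 1) → ℝ := fun _ => R with hb
  have hab : a ≤ b := fun i => by
    simp only [ha, hb]
    split_ifs <;> linarith
  have hsub : Set.Icc a b ⊆ upperHalf d := fun x hx => by
    simpa [ha, upperHalf] using hx.1 (Fin.last d)
  have hF (i : Fin (d + 1)) := contDiff_bochnerFlux hV hf i
  simp only [← sum_pd_bochnerFlux hV hf]
  have hmeas : MeasurableSet (upperHalf d) :=
    measurableSet_le measurable_const (measurable_pi_apply _)
  rw [setIntegral_eq_of_subset_of_forall_sdiff_eq_zero hmeas hsub]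
  · have hdiv := integral_divergence_of_hasFDerivAt_off_countable' a b hab (bochnerFlux V f)
      (fun i => fderiv ℝ (bochnerFlux V f i)) ∅ Set.countable_empty
      (fun i => (hF i).continuous.continuousOn)
      (fun x _ i => ((hF i).differentiableAt_of_smooth x).hasFDerivAt)
      (ContinuousOn.integrableOn_Icc
        (continuous_finsetSum _ fun i _ => ((hF i).pd i).continuous).continuousOn)
    refine hdiv.trans (Finset.sum_eq_zero fun i _ => ?_)
    have hfront (y : Fin d → ℝ) : bochnerFlux V f i (i.insertNth (b i) y) = 0 :=
      bochnerFlux_eq_zero_of_notMem_tsupport V i fun h => by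
        simpa [hb, abs_of_pos hRpos] using hsupp h i
    have hback (y : Fin d → ℝ) : bochnerFlux V f i (i.insertNth (a i) y) = 0 := by
      rcases eq_or_ne i (Fin.last d) with rfl | hi
      · exact bochnerFlux_last_eq_zero V hf hNeumann
          ((Fin.insertNth_apply_same _ _ _).trans (if_pos rfl))
      · exact bochnerFlux_eq_zero_of_notMem_tsupport V i fun h => by
          simpa [ha, hi, abs_of_pos hRpos] using hsupp h i
    simp [hfront, hback]
  · rintro x ⟨hxH, hxI⟩
    refine Finset.sum_eq_zero fun i _ => pd_bochnerFlux_eq_zero_of_notMem_tsupport V i fun h => ?_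
    refine hxI ⟨fun k => ?_, fun k => (abs_lt.1 (hsupp h k)).2.le⟩
    simp only [ha]
    split_ifs with hk
    · exact hk ▸ hxH
    · exact (abs_lt.1 (hsupp h k)).1.le
end

section
/- (Half-space case of Lemma 2.3(2).) Let d ≥ 2, let q : H → Sym_d(ℝ) be continuous and h : ℝ^{d−1} → ℝ continuous. Suppose that for every f ∈ C_c^∞(ℝ^d) with f(x̂, 0) = 0 for all x̂ one has ∫_H ⟨q(x) ∇f(x), ∇f(x)⟩ dx + ∫_{ℝ^{d−1}} h(x̂) |∇f(x̂,0)|² dx̂ ≥ 0. Then q(x) is positive semidefinite for every x ∈ H and h(x̂) ≥ 0 for every x̂ ∈ ℝ^{d−1}. -/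
open MeasureTheory Real

/-- The quadratic form `⟨M v, v⟩` of a matrix, in coordinates. -/
noncomputable def quadForm {n : ℕ} (M : Matrix (Fin n) (Fin n) ℝ) (v : Fin n → ℝ) : ℝ :=
  ∑ i, ∑ j, M i j * v i * v j

lemma pd_eq_zero_of_notMem_tsupport {n : ℕ} (i : Fin n) {f : (Fin n → ℝ) → ℝ} {x : Fin n → ℝ}
    (hx : x ∉ tsupport f) : pd i f x = 0 := by
  have : fderiv ℝ f x = 0 := by
    by_contra hne
    exact hx (support_fderiv_subset ℝ hne)
  simp [pd, this]

lemma continuous_pd {n : ℕ} (i : Fin n) {f : (Fin n → ℝ) → ℝ} (hf : ContDiff ℝ (⊤ : ℕ∞) f) :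
    Continuous (pd i f) :=
  (hf.continuous_fderiv (by simp)).clm_apply continuous_const

lemma isClosed_upperHalf (d : ℕ) : IsClosed (upperHalf d) :=
  isClosed_le continuous_const (continuous_apply _)

lemma continuousOn_quadForm {n : ℕ} {q : (Fin n → ℝ) → Matrix (Fin n) (Fin n) ℝ}
    {w : (Fin n → ℝ) → Fin n → ℝ} {s : Set (Fin n → ℝ)} (hq : ContinuousOn q s)
    (hw : Continuous w) : ContinuousOn (fun x => quadForm (q x) (w x)) s := by
  unfold quadForm
  refine continuousOn_finsetSum _ fun i _ => continuousOn_finsetSum _ fun j _ => ?_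
  have hqij : ContinuousOn (fun x => q x i j) s :=
    (continuous_apply_apply i j).comp_continuousOn hq
  exact (hqij.mul ((continuous_apply i).comp hw).continuousOn).mul
    ((continuous_apply j).comp hw).continuousOn

lemma integrableOn_quadForm {d : ℕ} {q : (Fin (d + 1) → ℝ) → Matrix (Fin (d + 1)) (Fin (d + 1)) ℝ}
    (hq : ContinuousOn q (upperHalf d)) {w : (Fin (d + 1) → ℝ) → Fin (d + 1) → ℝ}
    (hw : Continuous w) {K : Set (Fin (d + 1) → ℝ)} (hK : IsCompact K)
    (hwK : ∀ x ∉ K, w x = 0) :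
    IntegrableOn (fun x => quadForm (q x) (w x)) (upperHalf d) := by
  have hcl := isClosed_upperHalf d
  refine IntegrableOn.of_forall_sdiff_eq_zero (s := K ∩ upperHalf d)
    (((continuousOn_quadForm hq hw).mono Set.inter_subset_right).integrableOn_compact
      (hK.inter_right hcl)) hcl.measurableSet fun x hx => ?_
  simp [quadForm, hwK x fun hxK => hx.2 ⟨hxK, hx.1⟩]

lemma pd_mul_mul_comp {n : ℕ} (i : Fin n) {φ : (Fin n → ℝ) → ℝ} {ℓ : (Fin n → ℝ) →L[ℝ] ℝ}
    (hφ : ContDiff ℝ (⊤ : ℕ∞) φ) {u u' : ℝ → ℝ} (hu : ∀ t, HasDerivAt u (u' t) t) {N : ℝ}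
    (hN : N ≠ 0) (x : Fin n → ℝ) :
    pd i (fun y => N⁻¹ * (φ y * u (N * ℓ y))) x
      = N⁻¹ * pd i φ x * u (N * ℓ x) + φ x * u' (N * ℓ x) * ℓ (Pi.single i 1) := by
  have h1 : HasFDerivAt φ (fderiv ℝ φ x) x := (hφ.differentiable (by simp) x).hasFDerivAt
  have h2 : HasFDerivAt (fun y => u (N * ℓ y)) (u' (N * ℓ x) • (N • ℓ)) x :=
    (hu _).comp_hasFDerivAt x (ℓ.hasFDerivAt.const_mul N)
  have h3 : fderiv ℝ (fun y => N⁻¹ * (φ y * u (N * ℓ y))) x = _ :=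
    ((h1.mul h2).const_mul N⁻¹).fderiv
  simp [pd, h3]
  field_simp
  ring

section HalfSpace

variable {d : ℕ} {q : (Fin (d + 1) → ℝ) → Matrix (Fin (d + 1)) (Fin (d + 1)) ℝ}
  {h : (Fin d → ℝ) → ℝ}

/-- Testing against functions supported in the open half-space involves only the bulk term. -/
lemma integral_quadForm_nonneg
    (hpos : ∀ f : (Fin (d + 1) → ℝ) → ℝ, ContDiff ℝ (⊤ : ℕ∞) f → HasCompactSupport f →
      (∀ xb : Fin d → ℝ, f (Fin.snoc xb 0) = 0) →
      0 ≤ (∫ x in upperHalf d, ∑ i, ∑ j, q x i j * pd i f x * pd j f x)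
          + ∫ xb : Fin d → ℝ, h xb * ∑ i, (pd i f (Fin.snoc xb 0)) ^ 2)
    {f : (Fin (d + 1) → ℝ) → ℝ} (hf : ContDiff ℝ (⊤ : ℕ∞) f) (hfc : HasCompactSupport f)
    (hfs : ∀ x ∈ tsupport f, 0 < x (Fin.last d)) :
    0 ≤ ∫ x in upperHalf d, quadForm (q x) (fun i => pd i f x) := by
  have hb : ∀ xb : Fin d → ℝ, (Fin.snoc xb 0 : Fin (d + 1) → ℝ) ∉ tsupport f := fun xb hx => by
    simpa using hfs _ hx
  have := hpos f hf hfc fun xb => image_eq_zero_of_notMem_tsupport (hb xb)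
  simpa [pd_eq_zero_of_notMem_tsupport _ (hb _), quadForm] using this

/-- Testing against `N⁻¹ φ cos(N ℓ)` and `N⁻¹ φ sin(N ℓ)` and letting `N → ∞`. -/
lemma integral_quadForm_smul_nonneg
    (hqc : ContinuousOn q (upperHalf d))
    (hpos : ∀ f : (Fin (d + 1) → ℝ) → ℝ, ContDiff ℝ (⊤ : ℕ∞) f → HasCompactSupport f →
      (∀ xb : Fin d → ℝ, f (Fin.snoc xb 0) = 0) →
      0 ≤ (∫ x in upperHalf d, ∑ i, ∑ j, q x i j * pd i f x * pd j f x)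
          + ∫ xb : Fin d → ℝ, h xb * ∑ i, (pd i f (Fin.snoc xb 0)) ^ 2)
    {φ : (Fin (d + 1) → ℝ) → ℝ} (hφ : ContDiff ℝ (⊤ : ℕ∞) φ) (hφc : HasCompactSupport φ)
    (hφs : ∀ x ∈ tsupport φ, 0 < x (Fin.last d)) (v : Fin (d + 1) → ℝ) :
    0 ≤ ∫ x in upperHalf d, quadForm (q x) (φ x • v) := by
  let ℓ : (Fin (d + 1) → ℝ) →L[ℝ] ℝ := ∑ i, v i • ContinuousLinearMap.proj (R := ℝ) i
  have hℓ : ∀ i, ℓ (Pi.single i 1) = v i := fun i => by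
    simp [ℓ, Pi.single_apply]
  have key : ∀ u : ℝ → ℝ, ContDiff ℝ (⊤ : ℕ∞) u → ∀ N : ℝ,
      0 ≤ (∫ x in upperHalf d,
        quadForm (q x) (fun i => pd i (fun y => N⁻¹ * (φ y * u (N * ℓ y))) x)) ∧
      IntegrableOn (fun x =>
        quadForm (q x) (fun i => pd i (fun y => N⁻¹ * (φ y * u (N * ℓ y))) x)) (upperHalf d) := by
    intro u hu N
    have hsupp : tsupport (fun y => N⁻¹ * (φ y * u (N * ℓ y))) ⊆ tsupport φ := by
      refine closure_mono fun x hx hx0 => hx ?_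
      simp [hx0]
    have hs : ContDiff ℝ (⊤ : ℕ∞) (fun y => N⁻¹ * (φ y * u (N * ℓ y))) :=
      contDiff_const.mul (hφ.mul (hu.comp (contDiff_const.mul ℓ.contDiff)))
    refine ⟨integral_quadForm_nonneg hpos hs
      (hφc.of_isClosed_subset (isClosed_tsupport _) hsupp) fun x hx => hφs x (hsupp hx), ?_⟩
    exact integrableOn_quadForm hqc (continuous_pi fun i => continuous_pd i hs) hφc
      fun x hx => funext fun i => pd_eq_zero_of_notMem_tsupport i fun hx' => hx (hsupp hx')
  have hI : IntegrableOn (fun x => quadForm (q x) (φ x • v)) (upperHalf d) :=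
    integrableOn_quadForm hqc (hφ.continuous.smul continuous_const) hφc
      fun x hx => by simp [image_eq_zero_of_notMem_tsupport hx]
  have hJ : IntegrableOn (fun x => quadForm (q x) (fun i => pd i φ x)) (upperHalf d) :=
    integrableOn_quadForm hqc (continuous_pi fun i => continuous_pd i hφ) hφc
      fun x hx => funext fun i => pd_eq_zero_of_notMem_tsupport i hx
  have hN : ∀ n : ℕ, 0 ≤ (∫ x in upperHalf d, quadForm (q x) (φ x • v))
      + (1 / ((n : ℝ) + 1)) ^ 2 * ∫ x in upperHalf d, quadForm (q x) (fun i => pd i φ x) := by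
    intro n
    have hn : ((n : ℝ) + 1) ≠ 0 := by positivity
    obtain ⟨hc, hci⟩ := key cos contDiff_cos (n + 1)
    obtain ⟨hs, hsi⟩ := key sin contDiff_sin (n + 1)
    refine (add_nonneg hc hs).trans_eq ?_
    rw [← integral_add hci hsi, ← integral_const_mul, ← integral_add hI (hJ.const_mul _)]
    refine integral_congr_ae (Filter.Eventually.of_forall fun x => ?_)
    simp only [quadForm, Finset.mul_sum, ← Finset.sum_add_distrib]
    refine Finset.sum_congr rfl fun i _ => Finset.sum_congr rfl fun j _ => ?_
    simp only [pd_mul_mul_comp _ hφ hasDerivAt_cos hn, pd_mul_mul_comp _ hφ hasDerivAt_sin hn, hℓ,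
      Pi.smul_apply, smul_eq_mul, one_div]
    linear_combination (q x i j * ((n + 1 : ℝ)⁻¹ ^ 2 * pd i φ x * pd j φ x
      + φ x ^ 2 * v i * v j)) * sin_sq_add_cos_sq ((n + 1 : ℝ) * ℓ x)
  refine ge_of_tendsto' (x := Filter.atTop) ?_ hN
  have h0 := tendsto_one_div_add_atTop_nhds_zero_nat (𝕜 := ℝ)
  simpa using ((h0.pow 2).mul_const
    (∫ x in upperHalf d, quadForm (q x) (fun i => pd i φ x))).const_add
    (∫ x in upperHalf d, quadForm (q x) (φ x • v))

lemma quadForm_smul {n : ℕ} (M : Matrix (Fin n) (Fin n) ℝ) (c : ℝ) (v : Fin n → ℝ) :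
    quadForm M (c • v) = c ^ 2 * quadForm M v := by
  simp only [quadForm, Finset.mul_sum, Pi.smul_apply, smul_eq_mul]
  exact Finset.sum_congr rfl fun i _ => Finset.sum_congr rfl fun j _ => by ring

lemma quadForm_nonneg_of_pos_last
    (hqc : ContinuousOn q (upperHalf d))
    (hpos : ∀ f : (Fin (d + 1) → ℝ) → ℝ, ContDiff ℝ (⊤ : ℕ∞) f → HasCompactSupport f →
      (∀ xb : Fin d → ℝ, f (Fin.snoc xb 0) = 0) →
      0 ≤ (∫ x in upperHalf d, ∑ i, ∑ j, q x i j * pd i f x * pd j f x)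
          + ∫ xb : Fin d → ℝ, h xb * ∑ i, (pd i f (Fin.snoc xb 0)) ^ 2)
    {x₀ : Fin (d + 1) → ℝ} (hx₀ : 0 < x₀ (Fin.last d)) (v : Fin (d + 1) → ℝ) :
    0 ≤ quadForm (q x₀) v := by
  by_contra! hneg
  have hopen : {x : Fin (d + 1) → ℝ | 0 < x (Fin.last d)} ∈ nhds x₀ :=
    (isOpen_lt continuous_const (continuous_apply _)).mem_nhds hx₀
  have hH : upperHalf d ∈ nhds x₀ :=
    Filter.mem_of_superset hopen fun x (hx : 0 < x (Fin.last d)) => hx.le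
  have hev : ∀ᶠ x in nhds x₀, quadForm (q x) v < 0 ∧ 0 < x (Fin.last d) :=
    ((((continuousOn_quadForm hqc continuous_const).continuousAt hH).eventually_lt_const
      hneg)).and hopen
  obtain ⟨r, hr, hball⟩ := Metric.eventually_nhds_iff_ball.1 hev
  let φ : ContDiffBump x₀ := ⟨r / 4, r / 2, by positivity, by linarith⟩
  have hsub : tsupport φ ⊆ Metric.ball x₀ r := by
    rw [φ.tsupport_eq]
    exact Metric.closedBall_subset_ball (half_lt_self hr)
  have hnn := integral_quadForm_smul_nonneg hqc hpos φ.contDiff φ.hasCompactSupport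
    (fun x hx => (hball x (hsub hx)).2) v
  have hI : IntegrableOn (fun x => quadForm (q x) (φ x • v)) (upperHalf d) :=
    integrableOn_quadForm hqc (φ.continuous.smul continuous_const) φ.hasCompactSupport
      fun x hx => by simp [image_eq_zero_of_notMem_tsupport hx]
  have hle : ∀ x, 0 ≤ -quadForm (q x) (φ x • v) := by
    intro x
    rw [quadForm_smul]
    by_cases hx : x ∈ tsupport φ
    · nlinarith [(hball x (hsub hx)).1, sq_nonneg (φ x)]
    · simp [image_eq_zero_of_notMem_tsupport hx]
  have hpos' : 0 < ∫ x in upperHalf d, -quadForm (q x) (φ x • v) := by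
    rw [integral_pos_iff_support_of_nonneg hle hI.neg,
      Measure.restrict_apply' (isClosed_upperHalf d).measurableSet]
    refine (Metric.measure_ball_pos volume x₀ (half_pos hr)).trans_le (measure_mono fun x hx => ?_)
    have hx' := hball x (Metric.ball_subset_ball (half_le_self hr.le) hx)
    have hφx : 0 < φ x := φ.pos_of_mem_ball hx
    refine ⟨?_, hx'.2.le⟩
    rw [Function.mem_support, quadForm_smul]
    exact neg_ne_zero.2 (mul_ne_zero (pow_ne_zero 2 hφx.ne') hx'.1.ne)
  rw [integral_neg] at hpos'
  linarith

lemma quadForm_nonneg_of_mem_upperHalf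
    (hqc : ContinuousOn q (upperHalf d))
    (hpos : ∀ f : (Fin (d + 1) → ℝ) → ℝ, ContDiff ℝ (⊤ : ℕ∞) f → HasCompactSupport f →
      (∀ xb : Fin d → ℝ, f (Fin.snoc xb 0) = 0) →
      0 ≤ (∫ x in upperHalf d, ∑ i, ∑ j, q x i j * pd i f x * pd j f x)
          + ∫ xb : Fin d → ℝ, h xb * ∑ i, (pd i f (Fin.snoc xb 0)) ^ 2)
    {x : Fin (d + 1) → ℝ} (hx : x ∈ upperHalf d) (v : Fin (d + 1) → ℝ) :
    0 ≤ quadForm (q x) v := by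
  let y : ℕ → Fin (d + 1) → ℝ := fun n => x + (1 / ((n : ℝ) + 1)) • Pi.single (Fin.last d) 1
  have hy : ∀ n, 0 < y n (Fin.last d) := fun n => by
    have hx0 : 0 ≤ x (Fin.last d) := hx
    have : 0 < 1 / ((n : ℝ) + 1) := by positivity
    simp only [y, Pi.add_apply, Pi.smul_apply, Pi.single_eq_same, smul_eq_mul, mul_one]
    linarith
  have hty : Filter.Tendsto y Filter.atTop (nhds x) := by
    have h0 := tendsto_one_div_add_atTop_nhds_zero_nat (𝕜 := ℝ)
    simpa [y] using (h0.smul_const (Pi.single (Fin.last d) 1 : Fin (d + 1) → ℝ)).const_add x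
  have hty' : Filter.Tendsto y Filter.atTop (nhdsWithin x (upperHalf d)) :=
    tendsto_nhdsWithin_iff.2 ⟨hty, Filter.Eventually.of_forall fun n => (hy n).le⟩
  exact ge_of_tendsto' (((continuousOn_quadForm hqc (continuous_const (y := v))) x hx).tendsto.comp
    hty') fun n => quadForm_nonneg_of_pos_last hqc hpos (hy n) v

end HalfSpace

/-- The partial derivatives of `f` rescaled by a diagonal linear map. -/
lemma pd_comp_mul {n : ℕ} (i : Fin n) {f : (Fin n → ℝ) → ℝ} (hf : ContDiff ℝ (⊤ : ℕ∞) f) (ε : ℝ)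
    (c x : Fin n → ℝ) : pd i (fun y => ε * f (c * y)) x = ε * c i * pd i f (c * x) := by
  let L : (Fin n → ℝ) →L[ℝ] (Fin n → ℝ) :=
    ContinuousLinearMap.pi fun k => c k • ContinuousLinearMap.proj (R := ℝ) k
  have hL : ∀ y, L y = c * y := fun y => by ext k; simp [L]
  have h1 : HasFDerivAt f (fderiv ℝ f (L x)) (L x) :=
    (hf.differentiable (by simp) _).hasFDerivAt
  have h2 : fderiv ℝ (fun y => ε * f (L y)) x = _ :=
    ((h1.comp x L.hasFDerivAt).const_mul ε).fderiv
  have hc : c * Pi.single i 1 = c i • (Pi.single i 1 : Fin n → ℝ) := by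
    ext k
    by_cases hk : k = i
    · subst hk; simp
    · simp [hk]
  simp only [pd, ← hL]
  rw [h2]
  simp [hL, hc, mul_assoc]

section Rescaling

variable {d : ℕ}

/-- The diagonal of the linear map stretching the last coordinate by `n + 1`. -/
noncomputable def stretch (d n : ℕ) : Fin (d + 1) → ℝ :=
  Function.update 1 (Fin.last d) ((n : ℝ) + 1)

lemma one_le_stretch (n : ℕ) (i : Fin (d + 1)) : 1 ≤ stretch d n i := by
  by_cases hi : i = Fin.last d
  · subst hi; simp [stretch]
  · simp [stretch, hi]

lemma stretch_le (n : ℕ) (i : Fin (d + 1)) : stretch d n i ≤ (n : ℝ) + 1 := by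
  by_cases hi : i = Fin.last d
  · subst hi; simp [stretch]
  · simp [stretch, hi]

lemma stretch_last (n : ℕ) : stretch d n (Fin.last d) = (n : ℝ) + 1 := by simp [stretch]

lemma stretch_mul_snoc_zero (n : ℕ) (xb : Fin d → ℝ) :
    stretch d n * Fin.snoc xb 0 = (Fin.snoc xb 0 : Fin (d + 1) → ℝ) := by
  ext i
  refine Fin.lastCases ?_ (fun j => ?_) i
  · simp
  · simp [stretch, (Fin.castSucc_lt_last j).ne]

lemma norm_le_norm_stretch_mul (n : ℕ) (x : Fin (d + 1) → ℝ) : ‖x‖ ≤ ‖stretch d n * x‖ := by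
  refine (pi_norm_le_iff_of_nonneg (norm_nonneg _)).2 fun i => ?_
  refine le_trans ?_ (norm_le_pi_norm (stretch d n * x) i)
  have h1 := one_le_stretch n i
  rw [Pi.mul_apply, norm_mul, Real.norm_of_nonneg (by linarith : (0 : ℝ) ≤ stretch d n i)]
  exact le_mul_of_one_le_left (norm_nonneg _) h1

/-- The bulk term of the functions `G` squeezed onto the hyperplane `x_{d+1} = 0` vanishes
in the limit. -/
lemma tendsto_integral_quadForm_stretch
    {q : (Fin (d + 1) → ℝ) → Matrix (Fin (d + 1)) (Fin (d + 1)) ℝ}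
    (hqc : ContinuousOn q (upperHalf d))
    {G : (Fin (d + 1) → ℝ) → ℝ} (hG : ContDiff ℝ (⊤ : ℕ∞) G) (hGc : HasCompactSupport G) :
    Filter.Tendsto (fun n : ℕ => ∫ x in upperHalf d, quadForm (q x)
      (fun i => pd i (fun y => ((n : ℝ) + 1)⁻¹ * G (stretch d n * y)) x)) Filter.atTop
      (nhds 0) := by
  obtain ⟨R, hR⟩ := hGc.isBounded.exists_norm_le
  have hM : ∃ M : ℝ, ∀ (i : Fin (d + 1)) x, |pd i G x| ≤ M := by
    have : ∀ i : Fin (d + 1), ∃ M : ℝ, ∀ x, |pd i G x| ≤ M := fun i =>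
      (continuous_pd i hG).bounded_above_of_compact_support
        (HasCompactSupport.intro hGc fun x hx => pd_eq_zero_of_notMem_tsupport i hx)
    choose M hM using this
    exact ⟨∑ i, |M i|, fun i x => (hM i x).trans ((le_abs_self _).trans
      (Finset.single_le_sum (f := fun i => |M i|) (fun _ _ => abs_nonneg _) (Finset.mem_univ i)))⟩
  obtain ⟨M, hM⟩ := hM
  have hpd : ∀ (n : ℕ) i x, pd i (fun y => ((n : ℝ) + 1)⁻¹ * G (stretch d n * y)) x
      = ((n : ℝ) + 1)⁻¹ * stretch d n i * pd i G (stretch d n * x) :=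
    fun n i x => pd_comp_mul i hG _ _ x
  have hpd_le : ∀ (n : ℕ) i x,
      |pd i (fun y => ((n : ℝ) + 1)⁻¹ * G (stretch d n * y)) x| ≤ M := by
    intro n i x
    have hn : (0 : ℝ) < (n : ℝ) + 1 := by positivity
    have h0 : 0 ≤ ((n : ℝ) + 1)⁻¹ * stretch d n i :=
      mul_nonneg (by positivity) (zero_le_one.trans (one_le_stretch n i))
    have h1 : ((n : ℝ) + 1)⁻¹ * stretch d n i ≤ 1 := by
      rw [inv_mul_le_iff₀ hn, mul_one]
      exact stretch_le n i
    rw [hpd, abs_mul, abs_of_nonneg h0]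
    exact (mul_le_of_le_one_left (abs_nonneg _) h1).trans (hM i _)
  have hpd_zero : ∀ (n : ℕ) i x, R < ‖stretch d n * x‖ →
      pd i (fun y => ((n : ℝ) + 1)⁻¹ * G (stretch d n * y)) x = 0 := by
    intro n i x hx
    rw [hpd, pd_eq_zero_of_notMem_tsupport i fun hx' => hx.not_ge (hR _ hx'), mul_zero]
  have hsmooth : ∀ n : ℕ, ContDiff ℝ (⊤ : ℕ∞) fun y => ((n : ℝ) + 1)⁻¹ * G (stretch d n * y) :=
    fun n => contDiff_const.mul (hG.comp (contDiff_const.mul contDiff_id))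
  have hcl := isClosed_upperHalf d
  let K := Metric.closedBall (0 : Fin (d + 1) → ℝ) R
  let bound : (Fin (d + 1) → ℝ) → ℝ := K.indicator fun x => ∑ i, ∑ j, |q x i j| * M * M
  have hbound : IntegrableOn bound (upperHalf d) := by
    have hK : IsCompact K := isCompact_closedBall 0 R
    rw [IntegrableOn, integrable_indicator_iff hK.isClosed.measurableSet, IntegrableOn,
      Measure.restrict_restrict hK.isClosed.measurableSet]
    refine ContinuousOn.integrableOn_compact (hK.inter_right hcl) ?_
    refine continuousOn_finsetSum _ fun i _ => continuousOn_finsetSum _ fun j _ => ?_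
    have hqij : ContinuousOn (fun x => q x i j) (K ∩ upperHalf d) :=
      (continuous_apply_apply i j).comp_continuousOn (hqc.mono Set.inter_subset_right)
    exact (hqij.abs.mul continuousOn_const).mul continuousOn_const
  have hlim : ∫ _ in upperHalf d, (0 : ℝ) = 0 := by simp
  rw [← hlim]
  refine MeasureTheory.tendsto_integral_of_dominated_convergence bound (fun n => ?_) hbound
    (fun n => Filter.Eventually.of_forall fun x => ?_) ?_
  · exact (continuousOn_quadForm hqc (continuous_pi fun i =>
      continuous_pd i (hsmooth n))).aestronglyMeasurable hcl.measurableSet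
  · by_cases hx : x ∈ K
    · simp only [bound, Set.indicator_of_mem hx, quadForm]
      refine norm_sum_le_of_le _ fun i _ => norm_sum_le_of_le _ fun j _ => ?_
      rw [norm_mul, norm_mul]
      have hM0 : 0 ≤ M := (abs_nonneg _).trans (hM i x)
      exact mul_le_mul (mul_le_mul_of_nonneg_left (hpd_le n i x) (abs_nonneg _)) (hpd_le n j x)
        (abs_nonneg _) (by positivity)
    · have hx' : R < ‖x‖ := by simpa [K] using hx
      have hz : ∀ i, pd i (fun y => ((n : ℝ) + 1)⁻¹ * G (stretch d n * y)) x = 0 :=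
        fun i => hpd_zero n i x (hx'.trans_le (norm_le_norm_stretch_mul n x))
      simp [quadForm, hz, bound, hx]
  · have hnull : ∀ᵐ x : Fin (d + 1) → ℝ ∂(volume.restrict (upperHalf d)), x (Fin.last d) ≠ 0 := by
      refine ae_restrict_of_ae ?_
      rw [ae_iff]
      simpa [volume_pi] using
        Measure.pi_hyperplane (fun _ : Fin (d + 1) => (volume : Measure ℝ)) (Fin.last d) 0
    filter_upwards [hnull] with x hx
    refine tendsto_const_nhds.congr' ?_
    obtain ⟨m, hm⟩ := exists_nat_gt (R / |x (Fin.last d)|)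
    filter_upwards [Filter.eventually_ge_atTop m] with n hn
    have hx0 : 0 < |x (Fin.last d)| := abs_pos.2 hx
    have hRn : R < ‖stretch d n * x‖ := by
      refine lt_of_lt_of_le ?_ (norm_le_pi_norm (stretch d n * x) (Fin.last d))
      have hmn : (m : ℝ) ≤ n := by exact_mod_cast hn
      rw [Pi.mul_apply, stretch_last, norm_mul, Real.norm_of_nonneg (by positivity),
        Real.norm_eq_abs, ← div_lt_iff₀ hx0]
      linarith
    simp [quadForm, hpd_zero n _ x hRn]

lemma boundary_coeff_nonneg
    {q : (Fin (d + 1) → ℝ) → Matrix (Fin (d + 1)) (Fin (d + 1)) ℝ} {h : (Fin d → ℝ) → ℝ}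
    (hqc : ContinuousOn q (upperHalf d)) (hhc : Continuous h)
    (hpos : ∀ f : (Fin (d + 1) → ℝ) → ℝ, ContDiff ℝ (⊤ : ℕ∞) f → HasCompactSupport f →
      (∀ xb : Fin d → ℝ, f (Fin.snoc xb 0) = 0) →
      0 ≤ (∫ x in upperHalf d, ∑ i, ∑ j, q x i j * pd i f x * pd j f x)
          + ∫ xb : Fin d → ℝ, h xb * ∑ i, (pd i f (Fin.snoc xb 0)) ^ 2)
    (x₀ : Fin d → ℝ) : 0 ≤ h x₀ := by
  by_contra! hneg
  obtain ⟨r, hr, hball⟩ :=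
    Metric.eventually_nhds_iff_ball.1 (hhc.continuousAt.eventually_lt_const hneg)
  let B : ContDiffBump (Fin.snoc x₀ 0 : Fin (d + 1) → ℝ) :=
    ⟨r / 4, r / 2, by positivity, by linarith⟩
  let G : (Fin (d + 1) → ℝ) → ℝ := fun x => x (Fin.last d) * B x
  have hG : ContDiff ℝ (⊤ : ℕ∞) G := (contDiff_apply ℝ ℝ (Fin.last d)).mul B.contDiff
  have hGc : HasCompactSupport G := B.hasCompactSupport.mul_left
  have hG0 : ∀ xb : Fin d → ℝ, G (Fin.snoc xb 0) = 0 := fun xb => by simp [G]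
  have hpdG : ∀ (i : Fin (d + 1)) (xb : Fin d → ℝ), pd i G (Fin.snoc xb 0)
      = if i = Fin.last d then B (Fin.snoc xb 0) else 0 := by
    intro i xb
    have h1 : HasFDerivAt (fun x : Fin (d + 1) → ℝ => x (Fin.last d))
        (ContinuousLinearMap.proj (R := ℝ) (φ := fun _ : Fin (d + 1) => ℝ) (Fin.last d))
        (Fin.snoc xb 0) := hasFDerivAt_apply _ _
    have h2 := h1.mul ((B.contDiff (n := 1)).differentiable (by simp)
      (Fin.snoc xb 0)).hasFDerivAt
    have h3 : fderiv ℝ G (Fin.snoc xb 0) = _ := h2.fderiv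
    simp [pd, h3, Pi.single_apply, eq_comm]
  let c : ℝ := ∫ xb : Fin d → ℝ, h xb * B (Fin.snoc xb 0) ^ 2
  have hge : ∀ n : ℕ, 0 ≤ (∫ x in upperHalf d, quadForm (q x)
      (fun i => pd i (fun y => ((n : ℝ) + 1)⁻¹ * G (stretch d n * y)) x)) + c := by
    intro n
    have hn : ((n : ℝ) + 1) ≠ 0 := by positivity
    have hs : ContDiff ℝ (⊤ : ℕ∞) fun y => ((n : ℝ) + 1)⁻¹ * G (stretch d n * y) :=
      contDiff_const.mul (hG.comp (contDiff_const.mul contDiff_id))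
    obtain ⟨R, hR⟩ := hGc.isBounded.exists_norm_le
    have hsc : HasCompactSupport fun y => ((n : ℝ) + 1)⁻¹ * G (stretch d n * y) := by
      refine HasCompactSupport.intro (isCompact_closedBall 0 R) fun x hx => ?_
      have hx' : R < ‖x‖ := by simpa using hx
      rw [image_eq_zero_of_notMem_tsupport fun hx2 =>
        (hx'.trans_le (norm_le_norm_stretch_mul n x)).not_ge (hR _ hx2), mul_zero]
    have := hpos _ hs hsc fun xb => by rw [stretch_mul_snoc_zero, hG0, mul_zero]
    simpa [pd_comp_mul _ hG, stretch_mul_snoc_zero, hpdG, stretch_last, hn, quadForm, c]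
      using this
  have hc : 0 ≤ c := by
    simpa using ge_of_tendsto' ((tendsto_integral_quadForm_stretch hqc hG hGc).add_const c) hge
  have hBout : ∀ xb ∉ Metric.ball x₀ r, B (Fin.snoc xb 0) = 0 := by
    intro xb hxb
    refine B.zero_of_le_dist ?_
    have hd : dist xb x₀ ≤ dist (Fin.snoc xb 0 : Fin (d + 1) → ℝ) (Fin.snoc x₀ 0) := by
      refine (dist_pi_le_iff dist_nonneg).2 fun i => ?_
      simpa using dist_le_pi_dist (Fin.snoc xb 0 : Fin (d + 1) → ℝ) (Fin.snoc x₀ 0) i.castSucc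
    have hxb' : r ≤ dist xb x₀ := by simpa using hxb
    change r / 2 ≤ _
    linarith
  have hcont : Continuous fun xb : Fin d → ℝ => -(h xb * B (Fin.snoc xb 0) ^ 2) :=
    (hhc.mul ((B.continuous.comp (continuous_id.finSnoc continuous_const)).pow 2)).neg
  have hlt : 0 < ∫ xb : Fin d → ℝ, -(h xb * B (Fin.snoc xb 0) ^ 2) := by
    refine hcont.integral_pos_of_hasCompactSupport_nonneg_nonzero (x := x₀) ?_ (fun xb => ?_) ?_
    · refine HasCompactSupport.intro (isCompact_closedBall x₀ r) fun xb hxb => ?_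
      simp [hBout xb fun hx => hxb (Metric.ball_subset_closedBall hx)]
    · by_cases hxb : xb ∈ Metric.ball x₀ r
      · simpa using mul_nonpos_of_nonpos_of_nonneg (hball xb hxb).le (sq_nonneg _)
      · simp [hBout xb hxb]
    · have : 0 < B (Fin.snoc x₀ 0) := B.pos_of_mem_ball (Metric.mem_ball_self B.rOut_pos)
      exact neg_ne_zero.2 (mul_ne_zero hneg.ne (pow_ne_zero 2 this.ne'))
  rw [integral_neg] at hlt
  exact absurd hc (by simpa [c] using hlt)

end Rescaling

/-- half-space case of Lemma 2.3(2): if `q` is a continuous field of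
symmetric matrices on `H` and `h : ℝ^{d-1} → ℝ` is continuous, and
`∫_H ⟨q ∇f, ∇f⟩ dx + ∫_{∂H} h |∇f(·,0)|² dxb ≥ 0` for every `f ∈ C_c^∞(ℝ^d)`
satisfying the Dirichlet condition `f(·,0) = 0`, then `q` is positive semidefinite
on `H` and `h ≥ 0` everywhere.
(Ambient dimension is `d + 1` with `d ≥ 1`, i.e. dimension `≥ 2`.) -/
theorem half_space_matrix_field_nonneg_dirichlet
    (d : ℕ) (hd : 1 ≤ d)
    (q : (Fin (d + 1) → ℝ) → Matrix (Fin (d + 1)) (Fin (d + 1)) ℝ)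
    (h : (Fin d → ℝ) → ℝ)
    (hqc : ContinuousOn q (upperHalf d)) (hhc : Continuous h)
    (hqs : ∀ x ∈ upperHalf d, (q x).IsSymm)
    (hpos : ∀ f : (Fin (d + 1) → ℝ) → ℝ, ContDiff ℝ (⊤ : ℕ∞) f → HasCompactSupport f →
      (∀ xb : Fin d → ℝ, f (Fin.snoc xb 0) = 0) →
      0 ≤ (∫ x in upperHalf d, ∑ i, ∑ j, q x i j * pd i f x * pd j f x)
          + ∫ xb : Fin d → ℝ, h xb * ∑ i, (pd i f (Fin.snoc xb 0)) ^ 2) :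
    (∀ x ∈ upperHalf d, (q x).PosSemidef) ∧ (∀ xb, 0 ≤ h xb) := by
  refine ⟨fun x hx => ?_, boundary_coeff_nonneg hqc hhc hpos⟩
  refine Matrix.PosSemidef.of_dotProduct_mulVec_nonneg ?_ fun v => ?_
  · exact (Matrix.conjTranspose_eq_transpose_of_trivial _).trans (hqs x hx)
  · refine (quadForm_nonneg_of_mem_upperHalf hqc hpos hx v).trans_eq ?_
    simp only [quadForm, dotProduct, Matrix.mulVec, star_trivial, Finset.mul_sum]
    exact Finset.sum_congr rfl fun i _ => Finset.sum_congr rfl fun j _ => by ring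
end
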